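/- Assume (H1) and let σ² = σ_μ² denote the variance of μ. For every integer h ≥ 0, the random variables N_1(ℳ^{(h)}) and N_2(ℳ^{(h)}) have the same distribution, and there exist constants c_1 > 0 and c_2 > 0 such that for every h, P(ℳ^{(h)} ∉ J_h) ≤ c_1 exp(−c_2 h^{1/3}). -/

import Mathlib

open scoped Classical
open Filter
noncomputable section

/-- Hypothesis (H1): `μ` is a probability distribution on ℕ, non-degenerate
(`μ 0 + μ 1 ≠ 1`), critical (mean 1), with support bounded by `K > 0`. -/
def H1 (μ : ℕ → ℝ) (K : ℕ) : Prop :=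
  (∀ k, 0 ≤ μ k) ∧ HasSum μ 1 ∧ μ 0 + μ 1 ≠ 1 ∧
    HasSum (fun k : ℕ => (k : ℝ) * μ k) 1 ∧ 0 < K ∧ ∀ k, K < k → μ k = 0

/-- The index set `I_K = {(k,j) : 1 ≤ j ≤ k ≤ K}` as a finset of `ℕ × ℕ`. -/
def IKfin (K : ℕ) : Finset (ℕ × ℕ) :=
  (Finset.range (K + 1) ×ˢ Finset.range (K + 1)).filter fun p => 1 ≤ p.2 ∧ p.2 ≤ p.1

/-- The index set `I_K` as a (finite) type. -/
def IK (K : ℕ) := {p : ℕ × ℕ // p ∈ IKfin K}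

instance (K : ℕ) : Fintype (IK K) := by unfold IK; infer_instance
instance (K : ℕ) : DecidableEq (IK K) := by unfold IK; infer_instance

/-- The multinomial probability `Q_h({m})` with parameters `h` and `p = (p_{k,j})`,
`p_{k,j} = μ_k`. -/
def Qmult (μ : ℕ → ℝ) (K h : ℕ) (m : IK K → ℕ) : ℝ :=
  if (∑ i, m i) = h then
    ((h.factorial : ℝ) / ∏ i, ((m i).factorial : ℝ)) * ∏ i : IK K, μ i.val.1 ^ m i
  else 0

/-- `N₁(a) = ∑_{(k,j)} (j-1) a_{k,j}`. -/
def N1 {K : ℕ} (a : IK K → ℕ) : ℕ := ∑ i, (i.val.2 - 1) * a i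

/-- `N₂(a) = ∑_{(k,j)} (k-j) a_{k,j}`. -/
def N2 {K : ℕ} (a : IK K → ℕ) : ℕ := ∑ i, (i.val.1 - i.val.2) * a i

/-- Variance of `μ` (whose mean is 1 under (H1)). -/
def gwVar (μ : ℕ → ℝ) : ℝ := ∑' k : ℕ, ((k : ℝ) - 1) ^ 2 * μ k

/-- The set `J_h` of contents `a ∈ ℕ^{I_K}` with `∑ a = h` whose `N₁` and `N₂` lie in
`[σ²h/2 - h^{2/3}, σ²h/2 + h^{2/3}]`. -/
def Jset (μ : ℕ → ℝ) (K h : ℕ) : Set (IK K → ℕ) :=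
  {a | (∑ i, a i) = h ∧
    |(N1 a : ℝ) - gwVar μ * h / 2| ≤ (h : ℝ) ^ ((2 : ℝ) / 3) ∧
    |(N2 a : ℝ) - gwVar μ * h / 2| ≤ (h : ℝ) ^ ((2 : ℝ) / 3)}

/-- The multinomial weight of `m` for the weights `p` and `h` trials. -/
def multinomialWeight {ι : Type*} [Fintype ι] (p : ι → ℝ) (h : ℕ) (m : ι → ℕ) : ℝ :=
  ((h.factorial : ℝ) / ∏ i, ((m i).factorial : ℝ)) * ∏ i, p i ^ m i

section Multinomial

variable {ι : Type*} [Fintype ι]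

lemma multinomialWeight_nonneg {p : ι → ℝ} (hp : ∀ i, 0 ≤ p i) (h : ℕ) (m : ι → ℕ) :
    0 ≤ multinomialWeight p h m :=
  mul_nonneg (by positivity) (Finset.prod_nonneg fun i _ => pow_nonneg (hp i) _)

/-- The multinomial theorem. -/
lemma sum_multinomialWeight [DecidableEq ι] (p : ι → ℝ) (h : ℕ) :
    ∑ m ∈ Finset.piAntidiag Finset.univ h, multinomialWeight p h m = (∑ i, p i) ^ h := by
  rw [Finset.sum_pow_eq_sum_piAntidiag]
  refine Finset.sum_congr rfl fun m hm => ?_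
  have hs : ∑ i, m i = h := (Finset.mem_piAntidiag.1 hm).1
  have hspec := Nat.multinomial_spec (s := Finset.univ) (f := m)
  rw [hs] at hspec
  have hpos : (∏ i, ((m i).factorial : ℝ)) ≠ 0 :=
    Finset.prod_ne_zero_iff.2 fun i _ => by positivity
  rw [multinomialWeight, ← hspec]
  push_cast
  field_simp

lemma multinomialWeight_mul_exp (p v : ι → ℝ) (t : ℝ) (h : ℕ) (m : ι → ℕ) :
    multinomialWeight p h m * Real.exp (t * ∑ i, v i * m i) =
      multinomialWeight (fun i => p i * Real.exp (t * v i)) h m := by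
  simp only [multinomialWeight, mul_pow, Finset.prod_mul_distrib, Finset.mul_sum, Real.exp_sum,
    ← Real.exp_nat_mul]
  rw [mul_assoc]
  congr 3 with i
  congr 1
  ring

lemma sum_mul_exp_le {p v : ι → ℝ} (hp : ∀ i, 0 ≤ p i) (hp1 : ∑ i, p i = 1)
    (hv : ∑ i, p i * v i = 0) {B t : ℝ} (hB : ∀ i, |v i| ≤ B) (ht : |t| * B ≤ 1) :
    ∑ i, p i * Real.exp (t * v i) ≤ Real.exp (t ^ 2 * B ^ 2) := by
  have hterm : ∀ i, p i * Real.exp (t * v i) ≤ p i + t * (p i * v i) + p i * (t ^ 2 * B ^ 2) := by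
    intro i
    have h1 : |t * v i| ≤ |t| * B := by
      rw [abs_mul]
      exact mul_le_mul_of_nonneg_left (hB i) (abs_nonneg t)
    have h2 := (abs_le.1 (Real.abs_exp_sub_one_sub_id_le (h1.trans ht))).2
    have h3 : (t * v i) ^ 2 ≤ t ^ 2 * B ^ 2 := by
      rw [← sq_abs, ← sq_abs t, ← mul_pow]
      exact pow_le_pow_left₀ (abs_nonneg _) h1 2
    calc p i * Real.exp (t * v i) ≤ p i * (1 + t * v i + t ^ 2 * B ^ 2) :=
          mul_le_mul_of_nonneg_left (by linarith) (hp i)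
      _ = _ := by ring
  calc ∑ i, p i * Real.exp (t * v i)
      ≤ ∑ i, (p i + t * (p i * v i) + p i * (t ^ 2 * B ^ 2)) :=
        Finset.sum_le_sum fun i _ => hterm i
    _ = t ^ 2 * B ^ 2 + 1 := by
        rw [Finset.sum_add_distrib, Finset.sum_add_distrib, ← Finset.mul_sum, ← Finset.sum_mul,
          hp1, hv]
        ring
    _ ≤ _ := Real.add_one_le_exp _

/-- Moment generating function bound for a centred linear statistic of a multinomial vector. -/
lemma sum_multinomialWeight_mul_exp_le [DecidableEq ι] {p v : ι → ℝ} (hp : ∀ i, 0 ≤ p i)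
    (hp1 : ∑ i, p i = 1) (hv : ∑ i, p i * v i = 0) {B t : ℝ} (hB : ∀ i, |v i| ≤ B)
    (ht : |t| * B ≤ 1) (h : ℕ) :
    ∑ m ∈ Finset.piAntidiag Finset.univ h,
      multinomialWeight p h m * Real.exp (t * ∑ i, v i * m i) ≤
        Real.exp (h * (t ^ 2 * B ^ 2)) := by
  simp only [multinomialWeight_mul_exp]
  rw [sum_multinomialWeight, Real.exp_nat_mul]
  exact pow_le_pow_left₀
    (Finset.sum_nonneg fun i _ => mul_nonneg (hp i) (Real.exp_pos _).le)
    (sum_mul_exp_le hp hp1 hv hB ht) h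

/-- Chernoff bound at scale `h ^ (2/3)` for a centred linear statistic of a multinomial vector. -/
lemma exists_multinomial_tail_le [DecidableEq ι] {p v : ι → ℝ} (hp : ∀ i, 0 ≤ p i)
    (hp1 : ∑ i, p i = 1) (hv : ∑ i, p i * v i = 0) :
    ∃ c > (0 : ℝ), ∀ h : ℕ,
      (∑ m ∈ Finset.piAntidiag Finset.univ h,
        if (h : ℝ) ^ ((2 : ℝ) / 3) < |∑ i, v i * m i| then multinomialWeight p h m else 0) ≤
        2 * Real.exp (-c * (h : ℝ) ^ ((1 : ℝ) / 3)) := by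
  obtain ⟨B, hB1, hB⟩ : ∃ B : ℝ, 1 ≤ B ∧ ∀ i, |v i| ≤ B :=
    ⟨1 + ∑ i, |v i|, by linarith [Finset.sum_nonneg fun i (_ : i ∈ Finset.univ) => abs_nonneg (v i)],
      fun i => by
        linarith [Finset.single_le_sum (fun j _ => abs_nonneg (v j)) (Finset.mem_univ i)]⟩
  refine ⟨1 / (4 * B ^ 2), by positivity, fun h => ?_⟩
  set s : ℝ := (h : ℝ) ^ ((1 : ℝ) / 3) with hs
  have hs0 : 0 ≤ s := by positivity
  have hs2 : (h : ℝ) ^ ((2 : ℝ) / 3) = s ^ 2 := by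
    rw [hs, ← Real.rpow_mul_natCast (by positivity)]
    norm_num
  have hs3 : (h : ℝ) = s ^ 3 := by
    rw [hs, ← Real.rpow_mul_natCast (by positivity)]
    norm_num
  have hs1 : s = 0 ∨ 1 ≤ s := by
    rcases Nat.eq_zero_or_pos h with h0 | h0
    · exact Or.inl (by simp [hs, h0])
    · exact Or.inr (Real.one_le_rpow (by exact_mod_cast h0) (by norm_num))
  set t : ℝ := 1 / (2 * B ^ 2) / s with htdef
  have ht0 : 0 ≤ t := by positivity
  have htB : t * B ≤ 1 := by
    rcases hs1 with h0 | h0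
    · simp [htdef, h0]
    · rw [htdef, div_div, div_mul_eq_mul_div, one_mul, div_le_one (by positivity)]
      nlinarith [mul_le_mul hB1 h0 zero_le_one (by linarith)]
  have hexp : h * (t ^ 2 * B ^ 2) - t * s ^ 2 = -(1 / (4 * B ^ 2)) * s := by
    rcases eq_or_ne s 0 with h0 | h0
    · simp [hs3, h0]
    · rw [hs3, htdef]
      field_simp
      ring
  have hmgf1 := sum_multinomialWeight_mul_exp_le hp hp1 hv hB
    (t := t) (by rwa [abs_of_nonneg ht0]) h
  have hmgf2 := sum_multinomialWeight_mul_exp_le hp hp1 hv hB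
    (t := -t) (by rwa [abs_neg, abs_of_nonneg ht0]) h
  rw [neg_sq] at hmgf2
  rw [hs2]
  calc _ ≤ ∑ m ∈ Finset.piAntidiag Finset.univ h,
        (multinomialWeight p h m * Real.exp (t * ∑ i, v i * m i) +
          multinomialWeight p h m * Real.exp (-t * ∑ i, v i * m i)) * Real.exp (-(t * s ^ 2)) := by
        refine Finset.sum_le_sum fun m _ => ?_
        have hw := multinomialWeight_nonneg hp h m
        split_ifs with hm
        · rw [← mul_add, mul_assoc, add_mul, ← Real.exp_add, ← Real.exp_add]
          refine le_mul_of_one_le_right hw ?_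
          rcases lt_abs.1 hm with h1 | h1
          · refine le_add_of_le_of_nonneg (Real.one_le_exp ?_) (Real.exp_pos _).le
            nlinarith
          · refine le_add_of_nonneg_of_le (Real.exp_pos _).le (Real.one_le_exp ?_)
            nlinarith
        · positivity
    _ ≤ (Real.exp (h * (t ^ 2 * B ^ 2)) + Real.exp (h * (t ^ 2 * B ^ 2))) *
          Real.exp (-(t * s ^ 2)) := by
        rw [← Finset.sum_mul, Finset.sum_add_distrib]
        gcongr
    _ = 2 * Real.exp (-(1 / (4 * B ^ 2)) * s) := by
        rw [← two_mul, mul_assoc, ← Real.exp_add, ← hexp, sub_eq_add_neg]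

end Multinomial

lemma mem_IKfin {K : ℕ} {p : ℕ × ℕ} : p ∈ IKfin K ↔ p.1 ≤ K ∧ 1 ≤ p.2 ∧ p.2 ≤ p.1 := by
  simp only [IKfin, Finset.mem_filter, Finset.mem_product, Finset.mem_range]
  lia

/-- The involution `(k, j) ↦ (k, k + 1 - j)` of `I_K`. -/
def IK.reflect (K : ℕ) : Equiv.Perm (IK K) :=
  Function.Involutive.toPerm
    (fun i => ⟨(i.val.1, i.val.1 + 1 - i.val.2), by
      have := mem_IKfin.1 i.2
      rw [mem_IKfin]
      lia⟩)
    (fun i => by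
      have := mem_IKfin.1 i.2
      refine Subtype.ext (Prod.ext rfl ?_)
      change i.val.1 + 1 - (i.val.1 + 1 - i.val.2) = i.val.2
      lia)

lemma IK.reflect_fst {K : ℕ} (i : IK K) : (IK.reflect K i).val.1 = i.val.1 := rfl

lemma IK.reflect_snd {K : ℕ} (i : IK K) : (IK.reflect K i).val.2 = i.val.1 + 1 - i.val.2 := rfl

lemma N1_comp_reflect {K : ℕ} (m : IK K → ℕ) : N1 (m ∘ IK.reflect K) = N2 m := by
  refine Eq.trans ?_ (Equiv.sum_comp (IK.reflect K) fun i => (i.val.1 - i.val.2) * m i)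
  refine Finset.sum_congr rfl fun i _ => ?_
  have := mem_IKfin.1 i.2
  rw [IK.reflect_fst, IK.reflect_snd, Function.comp_apply]
  congr 1
  lia

lemma Qmult_comp_reflect (μ : ℕ → ℝ) {K : ℕ} (h : ℕ) (m : IK K → ℕ) :
    Qmult μ K h (m ∘ IK.reflect K) = Qmult μ K h m := by
  have h1 : ∑ i, (m ∘ IK.reflect K) i = ∑ i, m i := Equiv.sum_comp (IK.reflect K) m
  have h2 : ∏ i, (((m ∘ IK.reflect K) i).factorial : ℝ) = ∏ i, ((m i).factorial : ℝ) :=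
    Equiv.prod_comp (IK.reflect K) fun i => ((m i).factorial : ℝ)
  have h3 : ∏ i : IK K, μ i.val.1 ^ (m ∘ IK.reflect K) i = ∏ i : IK K, μ i.val.1 ^ m i :=
    Equiv.prod_comp (IK.reflect K) fun i => μ i.val.1 ^ m i
  simp only [Qmult, h1, h2, h3]

lemma sum_IK {K : ℕ} (f : ℕ × ℕ → ℝ) :
    ∑ i : IK K, f i.val = ∑ k ∈ Finset.range (K + 1), ∑ j ∈ Finset.range k, f (k, j + 1) := by
  have h1 : ∑ i : IK K, f i.val = ∑ p ∈ IKfin K, f p := by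
    symm
    refine Finset.sum_subtype (IKfin K) (fun _ => Iff.rfl) f
  rw [h1, Finset.sum_sigma']
  refine Finset.sum_bij' (fun p _ => ⟨p.1, p.2 - 1⟩) (fun q _ => (q.1, q.2 + 1)) ?_ ?_ ?_ ?_ ?_
  · intro p hp
    have := mem_IKfin.1 hp
    simp only [Finset.mem_sigma, Finset.mem_range]
    lia
  · intro q hq
    simp only [Finset.mem_sigma, Finset.mem_range] at hq
    rw [mem_IKfin]
    lia
  · intro p hp
    have := mem_IKfin.1 hp
    exact Prod.ext rfl (Nat.sub_add_cancel this.2.1)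
  · intro q _
    rfl
  · intro p hp
    have := mem_IKfin.1 hp
    exact congrArg f (Prod.ext rfl (Nat.sub_add_cancel this.2.1).symm)

lemma H1.sum_range_mul {μ : ℕ → ℝ} {K : ℕ} (hμ : H1 μ K) (f : ℕ → ℝ) :
    ∑' k, f k * μ k = ∑ k ∈ Finset.range (K + 1), f k * μ k :=
  tsum_eq_sum fun k hk => by
    rw [hμ.2.2.2.2.2 k (by simpa using hk), mul_zero]

lemma H1.sum_weights {μ : ℕ → ℝ} {K : ℕ} (hμ : H1 μ K) : ∑ i : IK K, μ i.val.1 = 1 := by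
  rw [sum_IK fun p => μ p.1, ← hμ.2.2.2.1.tsum_eq, hμ.sum_range_mul]
  simp

lemma H1.sum_range_mul_pred {μ : ℕ → ℝ} {K : ℕ} (hμ : H1 μ K) :
    ∑ k ∈ Finset.range (K + 1), (k : ℝ) * (k - 1) * μ k = gwVar μ := by
  have h0 : ∑ k ∈ Finset.range (K + 1), μ k = 1 := by
    simpa [hμ.2.1.tsum_eq] using (hμ.sum_range_mul fun _ => 1).symm
  have h1 : ∑ k ∈ Finset.range (K + 1), (k : ℝ) * μ k = 1 := by
    rw [← hμ.sum_range_mul, hμ.2.2.2.1.tsum_eq]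
  have h2 : ∑ k ∈ Finset.range (K + 1), (k : ℝ) * (k - 1) * μ k =
      ∑ k ∈ Finset.range (K + 1), ((k : ℝ) - 1) ^ 2 * μ k +
        (∑ k ∈ Finset.range (K + 1), (k : ℝ) * μ k - ∑ k ∈ Finset.range (K + 1), μ k) := by
    rw [← Finset.sum_sub_distrib, ← Finset.sum_add_distrib]
    exact Finset.sum_congr rfl fun k _ => by ring
  rw [h2, h0, h1, sub_self, add_zero, gwVar, hμ.sum_range_mul]

lemma H1.sum_snd_sub_one {μ : ℕ → ℝ} {K : ℕ} (hμ : H1 μ K) :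
    ∑ i : IK K, μ i.val.1 * ((i.val.2 - 1 : ℕ) : ℝ) = gwVar μ / 2 := by
  rw [sum_IK fun p => μ p.1 * ((p.2 - 1 : ℕ) : ℝ), ← hμ.sum_range_mul_pred, Finset.sum_div]
  refine Finset.sum_congr rfl fun k _ => ?_
  have gauss : ∀ n : ℕ, ∑ j ∈ Finset.range n, (j : ℝ) = n * (n - 1) / 2 := by
    intro n
    induction n with
    | zero => simp
    | succ n ih =>
      rw [Finset.sum_range_succ, ih]
      push_cast
      ring
  simp only [Nat.add_sub_cancel]
  rw [← Finset.mul_sum, gauss]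
  ring

lemma H1.sum_fst_sub_snd {μ : ℕ → ℝ} {K : ℕ} (hμ : H1 μ K) :
    ∑ i : IK K, μ i.val.1 * ((i.val.1 - i.val.2 : ℕ) : ℝ) = gwVar μ / 2 := by
  refine Eq.trans ?_ ((Equiv.sum_comp (IK.reflect K) fun i =>
    μ i.val.1 * ((i.val.2 - 1 : ℕ) : ℝ)).trans hμ.sum_snd_sub_one)
  refine Finset.sum_congr rfl fun i _ => ?_
  have := mem_IKfin.1 i.2
  rw [IK.reflect_fst, IK.reflect_snd]
  congr 2
  lia

lemma sum_sub_const_mul {ι : Type*} [Fintype ι] (w : ι → ℕ) (a : ℝ) {m : ι → ℕ} {h : ℕ}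
    (hm : ∑ i, m i = h) :
    ∑ i, ((w i : ℝ) - a) * m i = ((∑ i, w i * m i : ℕ) : ℝ) - a * h := by
  rw [← hm]
  push_cast
  rw [Finset.mul_sum, ← Finset.sum_sub_distrib]
  exact Finset.sum_congr rfl fun i _ => by ring

lemma exists_multinomial_tail_le_of_mean {ι : Type*} [Fintype ι] [DecidableEq ι] {p : ι → ℝ}
    (hp : ∀ i, 0 ≤ p i) (hp1 : ∑ i, p i = 1) (w : ι → ℕ) {a : ℝ}
    (ha : ∑ i, p i * (w i : ℝ) = a) :
    ∃ c > (0 : ℝ), ∀ h : ℕ,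
      (∑ m ∈ Finset.piAntidiag Finset.univ h,
        if (h : ℝ) ^ ((2 : ℝ) / 3) < |((∑ i, w i * m i : ℕ) : ℝ) - a * h| then
          multinomialWeight p h m else 0) ≤
        2 * Real.exp (-c * (h : ℝ) ^ ((1 : ℝ) / 3)) := by
  obtain ⟨c, hc, H⟩ := exists_multinomial_tail_le (v := fun i => (w i : ℝ) - a) hp hp1 (by
    simp only [mul_sub, Finset.sum_sub_distrib, ← Finset.sum_mul, hp1, ha]
    ring)
  refine ⟨c, hc, fun h => le_of_eq_of_le ?_ (H h)⟩
  refine Finset.sum_congr rfl fun m hm => ?_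
  rw [sum_sub_const_mul w a (Finset.mem_piAntidiag.1 hm).1]

/-- Assume (H1) and let `σ² = gwVar μ`.  For every `h`, the random variables
`N₁(ℳ^{(h)})` and `N₂(ℳ^{(h)})` have the same distribution (here expressed by the
equality of the point masses of their laws), and there exist `c₁, c₂ > 0` such that
for every `h`, `P(ℳ^{(h)} ∉ J_h) ≤ c₁ exp(-c₂ h^{1/3})`. -/
theorem statement11
    (μ : ℕ → ℝ) (K : ℕ) (hμ : H1 μ K) :
    (∀ h v : ℕ,
      (∑' m : IK K → ℕ, if N1 m = v then Qmult μ K h m else 0) =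
      (∑' m : IK K → ℕ, if N2 m = v then Qmult μ K h m else 0)) ∧
    ∃ c₁ > (0 : ℝ), ∃ c₂ > (0 : ℝ), ∀ h : ℕ,
      (∑' m : IK K → ℕ, if m ∉ Jset μ K h then Qmult μ K h m else 0) ≤
        c₁ * Real.exp (-c₂ * (h : ℝ) ^ ((1 : ℝ) / 3)) := by
  refine ⟨fun h v => ?_, ?_⟩
  · rw [← ((IK.reflect K).arrowCongr (Equiv.refl ℕ)).tsum_eq]
    refine tsum_congr fun m => ?_
    change (if N1 (m ∘ IK.reflect K) = v then Qmult μ K h (m ∘ IK.reflect K) else 0) = _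
    rw [N1_comp_reflect, Qmult_comp_reflect]
  · have hp : ∀ i : IK K, 0 ≤ μ i.val.1 := fun i => hμ.1 _
    obtain ⟨c, hc, H⟩ := exists_multinomial_tail_le_of_mean hp hμ.sum_weights _ hμ.sum_snd_sub_one
    obtain ⟨d, hd, H'⟩ := exists_multinomial_tail_le_of_mean hp hμ.sum_weights _ hμ.sum_fst_sub_snd
    refine ⟨4, by norm_num, min c d, lt_min hc hd, fun h => ?_⟩
    rw [tsum_eq_sum (s := Finset.piAntidiag Finset.univ h) fun m hm => by
      have : ∑ i, m i ≠ h := fun hs => hm (Finset.mem_piAntidiag.2 ⟨hs, by simp⟩)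
      simp [Qmult, this]]
    have hs0 : (0 : ℝ) ≤ (h : ℝ) ^ ((1 : ℝ) / 3) := by positivity
    have hexp : ∀ e, min c d ≤ e → Real.exp (-e * (h : ℝ) ^ ((1 : ℝ) / 3)) ≤
        Real.exp (-min c d * (h : ℝ) ^ ((1 : ℝ) / 3)) := fun e he =>
      Real.exp_le_exp.2 (mul_le_mul_of_nonneg_right (neg_le_neg he) hs0)
    refine (Finset.sum_le_sum fun m hm => ?_).trans
      ((Finset.sum_add_distrib.trans_le (add_le_add (H h) (H' h))).trans
        (by linarith [hexp c (min_le_left _ _), hexp d (min_le_right _ _)]))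
    have hm' : ∑ i, m i = h := (Finset.mem_piAntidiag.1 hm).1
    have hQ : Qmult μ K h m = multinomialWeight (fun i : IK K => μ i.val.1) h m := if_pos hm'
    have hw := multinomialWeight_nonneg hp h m
    rw [hQ]
    by_cases hJ : m ∈ Jset μ K h
    · rw [if_neg (not_not.2 hJ)]
      positivity
    · have hJ' : (h : ℝ) ^ ((2 : ℝ) / 3) < |(N1 m : ℝ) - gwVar μ / 2 * h| ∨
          (h : ℝ) ^ ((2 : ℝ) / 3) < |(N2 m : ℝ) - gwVar μ / 2 * h| := by
        by_contra! hcon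
        rw [div_mul_eq_mul_div] at hcon
        exact hJ ⟨hm', hcon⟩
      rw [if_pos hJ]
      rcases hJ' with h1 | h1
      · exact le_add_of_le_of_nonneg (if_pos h1).ge (by positivity)
      · exact le_add_of_nonneg_of_le (by positivity) (if_pos h1).ge

end
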